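/- Let (X,d) be a Polish metric space, K, K' ∈ ℝ, and for each t ∈ (0,1] let κ_t be a Markov kernel from X to X such that W₂(κ_t(x,·), κ_t(y,·)) ≤ e^{−K't}·d(x,y) for all x, y ∈ X and t ∈ (0,1]. Let μ, ν be Borel probability measures on X and let q be an optimal coupling of μ and ν with ∫ d(x,y)² dq(x,y) = W₂(μ,ν)² < ∞. Assume that for all x, y ∈ X: limsup_{t→0⁺} (1/t)·(e^{2Kt}·W₂(κ_t(x,·), κ_t(y,·))² − d(x,y)²) ≤ 0. Then limsup_{t→0⁺} (1/t)·(e^{2Kt}·W₂(μκ_t, νκ_t)² − W₂(μ,ν)²) ≤ 0. -/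

import Mathlib

open MeasureTheory ProbabilityTheory Filter
open scoped ENNReal Topology

/-- A coupling of `μ` and `ν`: a probability measure on `X × X` with marginals `μ` and `ν`. -/
def IsCoupling {X : Type*} [MeasurableSpace X] (q : Measure (X × X)) (μ ν : Measure X) : Prop :=
  IsProbabilityMeasure q ∧ q.map Prod.fst = μ ∧ q.map Prod.snd = ν

/-- The L²-Kantorovich–Wasserstein distance `W₂(μ,ν)`, valued in `[0,∞]`. -/
noncomputable def W2 {X : Type*} [EDist X] [MeasurableSpace X] (μ ν : Measure X) : ℝ≥0∞ :=
  (sInf { c : ℝ≥0∞ | ∃ q : Measure (X × X), IsCoupling q μ ν ∧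
      c = ∫⁻ p, edist p.1 p.2 ^ 2 ∂q }) ^ ((1 : ℝ) / 2)

section Couplings

variable {X : Type*} [MeasurableSpace X]

lemma W2_sq [EDist X] (μ ν : Measure X) :
    W2 μ ν ^ 2 = sInf { c : ℝ≥0∞ | ∃ q : Measure (X × X), IsCoupling q μ ν ∧
      c = ∫⁻ p, edist p.1 p.2 ^ 2 ∂q } := by
  rw [W2, ← ENNReal.rpow_natCast, ← ENNReal.rpow_mul]
  norm_num

lemma W2_sq_le_of_isCoupling [EDist X] {μ ν : Measure X} {π : Measure (X × X)}
    (hπ : IsCoupling π μ ν) : W2 μ ν ^ 2 ≤ ∫⁻ p, edist p.1 p.2 ^ 2 ∂π := by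
  rw [W2_sq]
  exact sInf_le ⟨π, hπ, rfl⟩

lemma exists_isCoupling_lintegral_lt [EDist X] {μ ν : Measure X} {c : ℝ≥0∞}
    (hc : W2 μ ν ^ 2 < c) :
    ∃ π, IsCoupling π μ ν ∧ ∫⁻ p, edist p.1 p.2 ^ 2 ∂π < c := by
  rw [W2_sq, sInf_lt_iff] at hc
  obtain ⟨_, ⟨π, hπ, rfl⟩, h⟩ := hc
  exact ⟨π, hπ, h⟩

variable [MetricSpace X] [SecondCountableTopology X] [BorelSpace X]

lemma IsCoupling.edist_integral_le {μ ν : Measure X} {π : Measure (X × X)}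
    (hπ : IsCoupling π μ ν) {φ : X → ℝ} {B : ℝ} (hB : ∀ x y, dist (φ x) (φ y) ≤ B)
    {L : NNReal} (hφ : LipschitzWith L φ) :
    edist (∫ x, φ x ∂μ) (∫ x, φ x ∂ν)
      ≤ L * (∫⁻ p, edist p.1 p.2 ^ 2 ∂π) ^ ((1 : ℝ) / 2) := by
  obtain ⟨hprob, rfl, rfl⟩ := hπ
  have hint (f : X × X → X) (hf : Continuous f) : Integrable (fun p => φ (f p)) π := by
    obtain ⟨p₀⟩ : Nonempty (X × X) := nonempty_of_isProbabilityMeasure π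
    refine Integrable.of_bound (C := ‖φ (f p₀)‖ + B)
      (hφ.continuous.comp hf).aestronglyMeasurable (ae_of_all _ fun p => ?_)
    have h₁ := hB (f p) (f p₀)
    have h₂ := norm_le_norm_add_norm_sub' (φ (f p)) (φ (f p₀))
    rw [dist_eq_norm] at h₁
    linarith
  rw [integral_map measurable_fst.aemeasurable hφ.continuous.aestronglyMeasurable,
    integral_map measurable_snd.aemeasurable hφ.continuous.aestronglyMeasurable,
    edist_eq_enorm_sub, ← integral_sub (hint _ continuous_fst) (hint _ continuous_snd)]
  have hhold : ∫⁻ p : X × X, edist p.1 p.2 ∂π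
      ≤ (∫⁻ p, edist p.1 p.2 ^ 2 ∂π) ^ ((1 : ℝ) / 2) := by
    have := ENNReal.lintegral_mul_le_Lp_mul_Lq π (Real.HolderConjugate.two_two)
      (f := fun p : X × X => edist p.1 p.2) (g := fun _ => 1)
      (by fun_prop) (by fun_prop)
    simpa using this
  calc ‖∫ p, φ p.1 - φ p.2 ∂π‖ₑ ≤ ∫⁻ p, ‖φ p.1 - φ p.2‖ₑ ∂π := enorm_integral_le_lintegral_enorm _
    _ ≤ ∫⁻ p, L * edist p.1 p.2 ∂π := by
        refine lintegral_mono fun p => ?_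
        rw [← edist_eq_enorm_sub]
        exact hφ p.1 p.2
    _ = L * ∫⁻ p, edist p.1 p.2 ∂π := lintegral_const_mul _ (by fun_prop)
    _ ≤ _ := by gcongr

lemma edist_integral_le_of_W2_lt {μ ν : Measure X} {c : ℝ≥0∞} (hc : W2 μ ν < c)
    {φ : X → ℝ} {B : ℝ} (hB : ∀ x y, dist (φ x) (φ y) ≤ B) {L : NNReal}
    (hφ : LipschitzWith L φ) :
    edist (∫ x, φ x ∂μ) (∫ x, φ x ∂ν) ≤ L * c := by
  have hc' : W2 μ ν ^ 2 < c ^ 2 := by gcongr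
  obtain ⟨π, hπ, hlt⟩ := exists_isCoupling_lintegral_lt hc'
  refine (hπ.edist_integral_le hB hφ).trans ?_
  gcongr
  calc (∫⁻ p, edist p.1 p.2 ^ 2 ∂π) ^ ((1 : ℝ) / 2) ≤ (c ^ 2) ^ ((1 : ℝ) / 2) := by gcongr
    _ = c := by
      rw [← ENNReal.rpow_natCast, ← ENNReal.rpow_mul]
      norm_num

end Couplings

section WeakConvergence

lemma isTightMeasureSet_range_of_map {X : Type*} [MetricSpace X]
    [MeasurableSpace X] [BorelSpace X] {πs : ℕ → ProbabilityMeasure (X × X)}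
    (hfst : IsTightMeasureSet (Set.range fun n => (πs n : Measure (X × X)).map Prod.fst))
    (hsnd : IsTightMeasureSet (Set.range fun n => (πs n : Measure (X × X)).map Prod.snd)) :
    IsTightMeasureSet {((ρ : ProbabilityMeasure (X × X)) : Measure (X × X)) |
      ρ ∈ Set.range πs} := by
  rw [isTightMeasureSet_iff_exists_isCompact_measure_compl_le] at *
  intro ε hε
  obtain ⟨K₁, hK₁, h₁⟩ := hfst (ε / 2) (ENNReal.half_pos hε.ne')
  obtain ⟨K₂, hK₂, h₂⟩ := hsnd (ε / 2) (ENNReal.half_pos hε.ne')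
  refine ⟨K₁ ×ˢ K₂, hK₁.prod hK₂, ?_⟩
  rintro _ ⟨_, ⟨n, rfl⟩, rfl⟩
  have h₁' := h₁ _ ⟨n, rfl⟩
  have h₂' := h₂ _ ⟨n, rfl⟩
  rw [Measure.map_apply measurable_fst hK₁.measurableSet.compl] at h₁'
  rw [Measure.map_apply measurable_snd hK₂.measurableSet.compl] at h₂'
  calc (πs n : Measure (X × X)) (K₁ ×ˢ K₂)ᶜ
      ≤ (πs n : Measure (X × X)) (Prod.fst ⁻¹' K₁ᶜ ∪ Prod.snd ⁻¹' K₂ᶜ) := by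
        refine measure_mono fun p hp => ?_
        simp only [Set.mem_compl_iff, Set.mem_prod, Set.mem_union, Set.mem_preimage] at *
        tauto
    _ ≤ ε / 2 + ε / 2 := (measure_union_le _ _).trans (add_le_add h₁' h₂')
    _ = ε := ENNReal.add_halves ε

variable {X : Type*} [MetricSpace X] [SecondCountableTopology X] [MeasurableSpace X]
  [BorelSpace X]

lemma tendsto_of_tendsto_W2 {μs : ℕ → ProbabilityMeasure X} {μ : ProbabilityMeasure X}
    (h : Tendsto (fun n => W2 (μs n : Measure X) μ) atTop (𝓝 0)) :
    Tendsto μs atTop (𝓝 μ) := by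
  rw [tendsto_iff_forall_lipschitz_integral_tendsto]
  rintro φ ⟨B, hB⟩ ⟨L, hφ⟩
  rw [EMetric.tendsto_nhds]
  intro ε hε
  have hL : (L : ℝ≥0∞) + 1 ≠ 0 := by simp
  have hL' : (L : ℝ≥0∞) + 1 ≠ ⊤ := by simp
  wlog hfin : ε ≠ ⊤ generalizing ε
  · filter_upwards [this 1 one_pos ENNReal.one_ne_top] with n hn
    exact hn.trans (by simp_all)
  have hpos : 0 < ε / (L + 1) := ENNReal.div_pos hε.ne' hL'
  filter_upwards [h.eventually_lt_const (ENNReal.half_pos hpos.ne')] with n hn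
  refine (edist_integral_le_of_W2_lt hn hB hφ).trans_lt ?_
  calc (L : ℝ≥0∞) * (ε / (L + 1) / 2) ≤ (L + 1) * (ε / (L + 1) / 2) := by
        gcongr; exact le_self_add
    _ = ε / 2 := by rw [← mul_div_assoc, ENNReal.mul_div_cancel hL hL']
    _ < ε := ENNReal.half_lt_self hε.ne' hfin

lemma lintegral_edist_sq_le_of_tendsto {πs : ℕ → ProbabilityMeasure (X × X)}
    {π : ProbabilityMeasure (X × X)} (h : Tendsto πs atTop (𝓝 π)) {c : ℕ → ℝ≥0∞} {C : ℝ≥0∞}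
    (hc : ∀ n, ∫⁻ p, edist p.1 p.2 ^ 2 ∂(πs n : Measure (X × X)) ≤ c n)
    (hC : Tendsto c atTop (𝓝 C)) :
    ∫⁻ p, edist p.1 p.2 ^ 2 ∂(π : Measure (X × X)) ≤ C := by
  have key := lintegral_le_liminf_lintegral_of_forall_isOpen_measure_le_liminf_measure
    (f := fun p : X × X => dist p.1 p.2 ^ 2) (μ := π) (μs := fun n => πs n)
    (by fun_prop) (fun p => sq_nonneg _)
    (fun G hG => ProbabilityMeasure.le_liminf_measure_open_of_tendsto h hG)
  simp only [ENNReal.ofReal_pow dist_nonneg, ← edist_dist] at key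
  refine key.trans ?_
  rw [← hC.liminf_eq]
  exact liminf_le_liminf (Eventually.of_forall hc)

variable [CompleteSpace X]

lemma isTightMeasureSet_range_of_tendsto {μs : ℕ → ProbabilityMeasure X}
    {μ : ProbabilityMeasure X} (h : Tendsto μs atTop (𝓝 μ)) :
    IsTightMeasureSet {((ρ : ProbabilityMeasure X) : Measure X) | ρ ∈ Set.range μs} := by
  refine isTightMeasureSet_of_isCompact_closure ?_
  refine h.isCompact_insert_range.closure_of_subset ?_
  exact Set.subset_insert _ _

lemma W2_sq_le_of_tendsto {μs νs : ℕ → ProbabilityMeasure X} {μ ν : ProbabilityMeasure X}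
    (hμ : Tendsto μs atTop (𝓝 μ)) (hν : Tendsto νs atTop (𝓝 ν))
    {πs : ℕ → Measure (X × X)} (hπ : ∀ n, IsCoupling (πs n) (μs n : Measure X) (νs n))
    {c : ℕ → ℝ≥0∞} {C : ℝ≥0∞} (hc : ∀ n, ∫⁻ p, edist p.1 p.2 ^ 2 ∂(πs n) ≤ c n)
    (hC : Tendsto c atTop (𝓝 C)) :
    W2 (μ : Measure X) ν ^ 2 ≤ C := by
  let Q : ℕ → ProbabilityMeasure (X × X) := fun n => ⟨πs n, (hπ n).1⟩
  have hfst n : (Q n).map measurable_fst.aemeasurable = μs n := Subtype.ext (hπ n).2.1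
  have hsnd n : (Q n).map measurable_snd.aemeasurable = νs n := Subtype.ext (hπ n).2.2
  have htight : IsTightMeasureSet
      {((ρ : ProbabilityMeasure (X × X)) : Measure (X × X)) | ρ ∈ Set.range Q} := by
    refine isTightMeasureSet_range_of_map ?_ ?_
    · refine (isTightMeasureSet_range_of_tendsto hμ).subset ?_
      rintro _ ⟨n, rfl⟩
      exact ⟨μs n, ⟨n, rfl⟩, (hπ n).2.1.symm⟩
    · refine (isTightMeasureSet_range_of_tendsto hν).subset ?_
      rintro _ ⟨n, rfl⟩
      exact ⟨νs n, ⟨n, rfl⟩, (hπ n).2.2.symm⟩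
  obtain ⟨π, -, s, hs, hlim⟩ := (isCompact_closure_of_isTightMeasureSet htight).isSeqCompact
    (fun n => subset_closure (Set.mem_range_self n))
  have hπ' : IsCoupling (π : Measure (X × X)) μ ν := by
    refine ⟨inferInstance, ?_, ?_⟩
    · have h₁ := ProbabilityMeasure.tendsto_map_of_tendsto_of_continuous _ _ hlim continuous_fst
      simp only [Function.comp_apply, hfst] at h₁
      exact congrArg ProbabilityMeasure.toMeasure
        (tendsto_nhds_unique h₁ (hμ.comp hs.tendsto_atTop))
    · have h₁ := ProbabilityMeasure.tendsto_map_of_tendsto_of_continuous _ _ hlim continuous_snd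
      simp only [Function.comp_apply, hsnd] at h₁
      exact congrArg ProbabilityMeasure.toMeasure
        (tendsto_nhds_unique h₁ (hν.comp hs.tendsto_atTop))
  exact (W2_sq_le_of_isCoupling hπ').trans
    (lintegral_edist_sq_le_of_tendsto hlim (fun n => hc (s n)) (hC.comp hs.tendsto_atTop))

end WeakConvergence

section Mixtures

lemma exists_measurable_nat_dist_le {Y : Type*} [MetricSpace Y] [SecondCountableTopology Y]
    [MeasurableSpace Y] [OpensMeasurableSpace Y] {δ : ℝ} (hδ : 0 < δ) :
    ∃ idx : Y → ℕ, Measurable idx ∧ ∀ p p', idx p = idx p' → dist p p' ≤ δ := by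
  obtain ⟨A, hA, hbdd, hdiam, hcover, hdisj⟩ :=
    SeparableSpace.exists_measurable_partition_diam_le Y hδ
  have hmem p : ∃ n, p ∈ A n := by simpa using hcover.ge (Set.mem_univ p)
  classical
  refine ⟨fun p => Nat.find (hmem p), measurable_find hmem hA, fun p p' h => ?_⟩
  have h₁ := Nat.find_spec (hmem p)
  have h₂ := Nat.find_spec (hmem p')
  rw [← show Nat.find (hmem p) = Nat.find (hmem p') from h] at h₂
  exact (Metric.dist_le_diam_of_mem (hbdd _) h₁ h₂).trans (hdiam _)

lemma exists_almost_minimizer {Y : Type*} [Nonempty Y] (idx : Y → ℕ) {f : Y → ℝ≥0∞}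
    (hf : ∀ p, f p ≠ ⊤) {ε : ℝ≥0∞} (hε : ε ≠ 0) :
    ∃ z : ℕ → Y, ∀ p, idx (z (idx p)) = idx p ∧ f (z (idx p)) ≤ f p + ε := by
  have key (k : ℕ) : ∃ z, ∀ p, idx p = k → idx z = k ∧ f z ≤ f p + ε := by
    by_cases hk : ∃ p, idx p = k
    · obtain ⟨p₀, hp₀⟩ := hk
      have hfin : (⨅ p : {p // idx p = k}, f p) ≠ ⊤ :=
        ne_top_of_le_ne_top (hf p₀) (iInf_le (fun p : {p // idx p = k} => f p) ⟨p₀, hp₀⟩)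
      obtain ⟨z, hz⟩ := iInf_lt_iff.1 (ENNReal.lt_add_right hfin hε)
      refine ⟨z, fun p hp => ⟨z.2, hz.le.trans ?_⟩⟩
      gcongr
      exact iInf_le (fun p : {p // idx p = k} => f p) ⟨p, hp⟩
    · exact ⟨Classical.arbitrary Y, fun p hp => (hk ⟨p, hp⟩).elim⟩
  choose z hz using key
  exact ⟨z, fun p => hz _ p rfl⟩

lemma map_bind_of_map_eq {α β γ : Type*} [MeasurableSpace α] [MeasurableSpace β]
    [MeasurableSpace γ] {m : Measure α} {P : α → Measure β} {R : α → Measure γ}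
    (hP : Measurable P) {g : β → γ} (hg : Measurable g) (h : ∀ a, (P a).map g = R a) :
    (m.bind P).map g = m.bind R := by
  have hR : Measurable R := by
    rw [← funext h]
    exact (Measure.measurable_map g hg).comp hP
  ext s hs
  rw [Measure.map_apply hg hs, Measure.bind_apply (hg hs) hP.aemeasurable,
    Measure.bind_apply hs hR.aemeasurable]
  exact lintegral_congr fun a => by rw [← h a, Measure.map_apply hg hs]

lemma map_bind_eq_bind_comp {α β γ : Type*} [MeasurableSpace α] [MeasurableSpace β]
    [MeasurableSpace γ] {m : Measure α} {g : α → β} (hg : Measurable g) {R : β → Measure γ}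
    (hR : Measurable R) : (m.map g).bind R = m.bind (fun a => R (g a)) := by
  ext s hs
  have hRg : Measurable fun a => R (g a) := hR.comp hg
  rw [Measure.bind_apply hs hR.aemeasurable, Measure.bind_apply hs hRg.aemeasurable,
    lintegral_map (Measure.measurable_measure.1 hR s hs) hg]

lemma isCoupling_bind {X α : Type*} [MeasurableSpace X] [MeasurableSpace α] {m : Measure α}
    [IsProbabilityMeasure m]
    {P : α → Measure (X × X)} (hP : Measurable P) {R S : α → Measure X}
    (h : ∀ a, IsCoupling (P a) (R a) (S a)) :
    IsCoupling (m.bind P) (m.bind R) (m.bind S) :=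
  ⟨isProbabilityMeasure_bind hP.aemeasurable (ae_of_all _ fun a => (h a).1),
    map_bind_of_map_eq hP measurable_fst fun a => (h a).2.1,
    map_bind_of_map_eq hP measurable_snd fun a => (h a).2.2⟩

variable {X : Type*} [MetricSpace X] [MeasurableSpace X] [BorelSpace X]

/-- Mixing preserves pointwise weak convergence of kernels. -/
lemma tendsto_bind {α : Type*} [MeasurableSpace α] {m : Measure α} [IsProbabilityMeasure m]
    {R : ℕ → α → ProbabilityMeasure X} {S : α → ProbabilityMeasure X}
    (hR : ∀ n, Measurable fun a => (R n a : Measure X))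
    (hS : Measurable fun a => (S a : Measure X))
    (h : ∀ a, Tendsto (fun n => R n a) atTop (𝓝 (S a)))
    {ρs : ℕ → ProbabilityMeasure X} {ρ : ProbabilityMeasure X}
    (hρs : ∀ n, (ρs n : Measure X) = m.bind fun a => (R n a : Measure X))
    (hρ : (ρ : Measure X) = m.bind fun a => (S a : Measure X)) :
    Tendsto ρs atTop (𝓝 ρ) := by
  refine tendsto_of_forall_isOpen_le_liminf' fun G hG => ?_
  simp_rw [hρs, hρ, Measure.bind_apply hG.measurableSet hS.aemeasurable,
    Measure.bind_apply hG.measurableSet (hR _).aemeasurable]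
  calc ∫⁻ a, (S a : Measure X) G ∂m
      ≤ ∫⁻ a, liminf (fun n => (R n a : Measure X) G) atTop ∂m :=
        lintegral_mono fun a => ProbabilityMeasure.le_liminf_measure_open_of_tendsto (h a) hG
    _ ≤ _ := lintegral_liminf_le fun n => Measure.measurable_measure.1 (hR n) G hG.measurableSet

/-- Joint convexity of the squared Wasserstein distance along a Lipschitz Markov kernel. -/
lemma W2_sq_bind_le_lintegral [SecondCountableTopology X] [CompleteSpace X]
    {κ : Kernel X X} [IsMarkovKernel κ] {L : ℝ≥0∞} (hL : L ≠ ⊤)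
    (hκ : ∀ x y, W2 (κ x) (κ y) ≤ L * edist x y) {μ ν : Measure X}
    {q : Measure (X × X)} (hq : IsCoupling q μ ν) :
    W2 (μ.bind fun x => κ x) (ν.bind fun x => κ x) ^ 2
      ≤ ∫⁻ p, W2 (κ p.1) (κ p.2) ^ 2 ∂q := by
  obtain ⟨hprob, rfl, rfl⟩ := hq
  have : Nonempty (X × X) := nonempty_of_isProbabilityMeasure q
  let f : X × X → ℝ≥0∞ := fun p => W2 (κ p.1) (κ p.2) ^ 2
  have hf p : f p ≠ ⊤ := ENNReal.pow_ne_top <|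
    ne_top_of_le_ne_top (ENNReal.mul_ne_top hL (edist_ne_top _ _)) (hκ _ _)
  obtain ⟨δ, -, hδ, hδ0⟩ := exists_seq_strictAnti_tendsto (0 : ℝ)
  have hε n : ENNReal.ofReal (δ n) ≠ 0 := by simpa using hδ n
  choose idx hidx hdist using fun n => exists_measurable_nat_dist_le (Y := X × X) (hδ n)
  choose z hz using fun n => exists_almost_minimizer (idx n) hf (hε n)
  choose P hP hcost using fun n k =>
    exists_isCoupling_lintegral_lt (ENNReal.lt_add_right (hf (z n k)) (hε n))
  have hPm n : Measurable fun p => P n (idx n p) := measurable_from_nat.comp (hidx n)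
  have hzm n : Measurable fun p => z n (idx n p) := measurable_from_nat.comp (hidx n)
  have hδ0' : Tendsto (fun n => ENNReal.ofReal (δ n)) atTop (𝓝 0) := by
    simpa using ENNReal.tendsto_ofReal hδ0
  have hclose n p : edist (z n (idx n p)) p ≤ ENNReal.ofReal (δ n) := by
    rw [edist_dist]
    exact ENNReal.ofReal_le_ofReal (hdist n _ _ (hz n p).1)
  let κprob : X → ProbabilityMeasure X := fun x => ⟨κ x, inferInstance⟩
  have hlim (g : X × X → X) (hg : ∀ p p', edist (g p) (g p') ≤ edist p p') (p : X × X) :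
      Tendsto (fun n => κprob (g (z n (idx n p)))) atTop (𝓝 (κprob (g p))) := by
    refine tendsto_of_tendsto_W2 ?_
    have hlim0 : Tendsto (fun n => L * ENNReal.ofReal (δ n)) atTop (𝓝 0) := by
      simpa using ENNReal.Tendsto.const_mul hδ0' (Or.inr hL)
    refine tendsto_of_tendsto_of_tendsto_of_le_of_le tendsto_const_nhds hlim0
      (fun _ => zero_le) fun n => (hκ _ _).trans ?_
    gcongr
    exact (hg _ _).trans (hclose n p)
  have hbind (g : X × X → X) (hg : Measurable g) :
      IsProbabilityMeasure (q.bind fun p => κ (g p)) :=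
    isProbabilityMeasure_bind (κ.measurable.comp hg).aemeasurable
      (ae_of_all _ fun _ => inferInstance)
  let mix (g : X × X → X) (hg : Measurable g) : ProbabilityMeasure X :=
    ⟨q.bind fun p => κ (g p), hbind g hg⟩
  have hconv (g : X × X → X) (hgm : Measurable g)
      (hg : ∀ p p', edist (g p) (g p') ≤ edist p p') :
      Tendsto (fun n => mix _ (hgm.comp (hzm n))) atTop (𝓝 (mix g hgm)) :=
    tendsto_bind (m := q) (R := fun n p => κprob (g (z n (idx n p))))
      (S := fun p => κprob (g p)) (fun n => κ.measurable.comp (hgm.comp (hzm n)))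
      (κ.measurable.comp hgm) (hlim g hg) (fun _ => rfl) rfl
  rw [map_bind_eq_bind_comp measurable_fst κ.measurable,
    map_bind_eq_bind_comp measurable_snd κ.measurable]
  refine W2_sq_le_of_tendsto
    (hconv Prod.fst measurable_fst fun p p' => le_max_left _ _)
    (hconv Prod.snd measurable_snd fun p p' => le_max_right _ _)
    (fun n => isCoupling_bind (hPm n) fun p => hP n (idx n p))
    (c := fun n => ∫⁻ p, f p ∂q + (ENNReal.ofReal (δ n) + ENNReal.ofReal (δ n))) (fun n => ?_) ?_
  · rw [Measure.lintegral_bind (hPm n).aemeasurable (by fun_prop)]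
    calc ∫⁻ p, ∫⁻ p', edist p'.1 p'.2 ^ 2 ∂P n (idx n p) ∂q
        ≤ ∫⁻ p, f p + (ENNReal.ofReal (δ n) + ENNReal.ofReal (δ n)) ∂q := by
          refine lintegral_mono fun p => (hcost n _).le.trans ?_
          rw [← add_assoc]
          exact add_le_add_left (hz n p).2 _
      _ = _ := by rw [lintegral_add_right _ measurable_const]; simp
  · simpa using (tendsto_const_nhds (x := ∫⁻ p, f p ∂q)).add (hδ0'.add hδ0')

end Mixtures

lemma one_div_mul_exp_mul_sub_one_le (c : ℝ) {t : ℝ} (ht : t ∈ Set.Ioc (0 : ℝ) 1) :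
    (1 / t) * (Real.exp (c * t) - 1) ≤ |c| * Real.exp |c| := by
  have ht₀ : 0 < t := ht.1
  have hle : c * t ≤ |c| := by
    calc c * t ≤ |c| * t := by gcongr; exact le_abs_self c
      _ ≤ |c| * 1 := by gcongr; exact ht.2
      _ = |c| := mul_one _
  have h₁ : Real.exp (c * t) - 1 ≤ c * t * Real.exp (c * t) := by
    have h := mul_le_mul_of_nonneg_left (Real.add_one_le_exp (-(c * t))) (Real.exp_pos (c * t)).le
    rw [← Real.exp_add, add_neg_cancel, Real.exp_zero] at h
    linarith
  calc (1 / t) * (Real.exp (c * t) - 1) ≤ (1 / t) * (c * t * Real.exp (c * t)) := by gcongr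
    _ = c * Real.exp (c * t) := by field_simp
    _ ≤ |c| * Real.exp |c| := by gcongr; exact le_abs_self c

lemma one_div_mul_exp_mul_toReal_sub_le {K K' t d : ℝ} (ht : t ∈ Set.Ioc (0 : ℝ) 1)
    {w : ℝ≥0∞} (hw : w ≤ (ENNReal.ofReal (Real.exp (-K' * t)) * ENNReal.ofReal d) ^ 2)
    (hd : 0 ≤ d) :
    (1 / t) * (Real.exp (2 * K * t) * w.toReal - d ^ 2)
      ≤ |2 * K - 2 * K'| * Real.exp |2 * K - 2 * K'| * d ^ 2 := by
  have ht₀ : 0 < t := ht.1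
  rw [← ENNReal.ofReal_mul (Real.exp_pos _).le, ← ENNReal.ofReal_pow (by positivity)] at hw
  have hw' : w.toReal ≤ (Real.exp (-K' * t) * d) ^ 2 :=
    ENNReal.toReal_le_of_le_ofReal (by positivity) hw
  have hexp : Real.exp (2 * K * t) * Real.exp (-K' * t) ^ 2
      = Real.exp ((2 * K - 2 * K') * t) := by
    rw [← Real.exp_nat_mul, ← Real.exp_add]
    congr 1
    push_cast
    ring
  calc (1 / t) * (Real.exp (2 * K * t) * w.toReal - d ^ 2)
      ≤ (1 / t) * (Real.exp (2 * K * t) * (Real.exp (-K' * t) * d) ^ 2 - d ^ 2) := by gcongr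
    _ = (1 / t) * (Real.exp ((2 * K - 2 * K') * t) - 1) * d ^ 2 := by rw [← hexp]; ring
    _ ≤ _ := by
      exact mul_le_mul_of_nonneg_right (one_div_mul_exp_mul_sub_one_le _ ht) (sq_nonneg d)

/-- The real `limsup` is nonpositive once the function is eventually below every `ε > 0`, even
when it is unbounded below. -/
lemma limsup_nonpos_of_forall_pos_eventually_le {α : Type*} {l : Filter α} {u : α → ℝ}
    (h : ∀ ε > 0, ∀ᶠ a in l, u a ≤ ε) : limsup u l ≤ 0 := by
  by_cases hb : BddBelow {a | ∀ᶠ n in l, u n ≤ a}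
  · exact le_of_forall_pos_le_add fun ε hε => by
      simpa [limsup_eq] using csInf_le hb (h ε hε)
  · rw [limsup_eq, Real.sInf_of_not_bddBelow hb]

/-- Let `κ_t`, `t ∈ (0,1]`, be Markov kernels on a Polish metric space with
`W₂(κ_t(x,·),κ_t(y,·)) ≤ e^{−K't} d(x,y)`. Let `q` be an optimal coupling of probability
measures `μ, ν` with finite cost. If for all `x,y`
`limsup_{t→0⁺} (1/t)(e^{2Kt} W₂(κ_t(x,·),κ_t(y,·))² − d(x,y)²) ≤ 0`, then
`limsup_{t→0⁺} (1/t)(e^{2Kt} W₂(μκ_t,νκ_t)² − W₂(μ,ν)²) ≤ 0`. -/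
theorem limsup_wasserstein_expansion
    {X : Type*} [MetricSpace X] [CompleteSpace X] [SecondCountableTopology X]
    [MeasurableSpace X] [BorelSpace X]
    (K K' : ℝ) (κ : ℝ → Kernel X X)
    (hmarkov : ∀ t ∈ Set.Ioc (0 : ℝ) 1, IsMarkovKernel (κ t))
    (hcontr : ∀ t ∈ Set.Ioc (0 : ℝ) 1, ∀ x y : X,
      W2 ((κ t) x) ((κ t) y) ≤ ENNReal.ofReal (Real.exp (-K' * t)) * edist x y)
    (μ ν : Measure X) [IsProbabilityMeasure μ] [IsProbabilityMeasure ν]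
    (q : Measure (X × X)) (hq : IsCoupling q μ ν)
    (hqopt : ∫⁻ p, edist p.1 p.2 ^ 2 ∂q = W2 μ ν ^ 2)
    (hqfin : W2 μ ν < ⊤)
    (hpt : ∀ x y : X,
      limsup (fun t : ℝ =>
          (1 / t) * (Real.exp (2 * K * t) * ((W2 ((κ t) x) ((κ t) y)).toReal) ^ 2
            - dist x y ^ 2)) (𝓝[>] (0 : ℝ)) ≤ 0) :
    limsup (fun t : ℝ =>
        (1 / t) * (Real.exp (2 * K * t)
            * ((W2 (μ.bind (fun x => (κ t) x)) (ν.bind (fun x => (κ t) x))).toReal) ^ 2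
          - ((W2 μ ν).toReal) ^ 2)) (𝓝[>] (0 : ℝ)) ≤ 0 := by
  have hprob := hq.1
  have hsmall : ∀ᶠ t : ℝ in 𝓝[>] 0, t ∈ Set.Ioc (0 : ℝ) 1 := Ioc_mem_nhdsGT one_pos
  set C : ℝ := |2 * K - 2 * K'| * Real.exp |2 * K - 2 * K'|
  have hbound : ∀ t ∈ Set.Ioc (0 : ℝ) 1, ∀ x y,
      W2 (κ t x) (κ t y) ^ 2
        ≤ (ENNReal.ofReal (Real.exp (-K' * t)) * ENNReal.ofReal (dist x y)) ^ 2 := by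
    intro t ht x y
    rw [← edist_dist]
    gcongr
    exact hcontr t ht x y
  have hpt' : ∀ p : X × X, ∀ ε > 0, ∀ᶠ t : ℝ in 𝓝[>] 0,
      (1 / t) * (Real.exp (2 * K * t) * (W2 (κ t p.1) (κ t p.2) ^ 2).toReal
        - dist p.1 p.2 ^ 2) < ε := by
    intro p ε hε
    simp only [ENNReal.toReal_pow]
    refine eventually_lt_of_limsup_lt ((hpt p.1 p.2).trans_lt hε)
      ⟨C * dist p.1 p.2 ^ 2, ?_⟩
    rw [eventually_map]
    filter_upwards [hsmall] with t ht
    rw [← ENNReal.toReal_pow]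
    exact one_div_mul_exp_mul_toReal_sub_le ht (hbound t ht _ _) dist_nonneg
  have hcost : ∫⁻ p, ENNReal.ofReal (dist p.1 p.2 ^ 2) ∂q = W2 μ ν ^ 2 := by
    simpa only [ENNReal.ofReal_pow dist_nonneg, ← edist_dist] using hqopt
  have hdist : Integrable (fun p : X × X => dist p.1 p.2 ^ 2) q := by
    refine ⟨by fun_prop, ?_⟩
    rw [hasFiniteIntegral_iff_ofReal (ae_of_all _ fun p => sq_nonneg _), hcost]
    exact ENNReal.pow_lt_top hqfin
  have hdist_int : (W2 μ ν).toReal ^ 2 = ∫ p, dist p.1 p.2 ^ 2 ∂q := by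
    rw [integral_eq_lintegral_of_nonneg_ae (ae_of_all _ fun p => sq_nonneg _) (by fun_prop),
      hcost, ENNReal.toReal_pow]
  refine limsup_nonpos_of_forall_pos_eventually_le fun ε hε => ?_
  by_contra hcon
  obtain ⟨s, hs, hbad⟩ :=
    exists_seq_forall_of_frequently ((not_eventually.1 hcon).and_eventually hsmall)
  choose g hgm hgle hgint using fun n =>
    exists_measurable_le_lintegral_eq q (fun p => W2 (κ (s n) p.1) (κ (s n) p.2) ^ 2)
  have hg n p : g n p ≤ (ENNReal.ofReal (Real.exp (-K' * s n))
      * ENNReal.ofReal (dist p.1 p.2)) ^ 2 := (hgle n p).trans (hbound _ (hbad n).2 _ _)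
  have hg_top n p : g n p < ⊤ := (hg n p).trans_lt (by finiteness)
  let h : ℕ → X × X → ℝ := fun n p =>
    (1 / s n) * (Real.exp (2 * K * s n) * (g n p).toReal - dist p.1 p.2 ^ 2)
  have hh_le n p : h n p ≤ C * dist p.1 p.2 ^ 2 :=
    one_div_mul_exp_mul_toReal_sub_le (hbad n).2 (hg n p) dist_nonneg
  have hh_meas n : Measurable (h n) :=
    (((hgm n).ennreal_toReal.const_mul _).sub (by fun_prop)).const_mul _
  have hC0 : 0 ≤ C := by positivity
  have hmax n p : ‖max (h n p) 0‖ ≤ C * dist p.1 p.2 ^ 2 := by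
    rw [Real.norm_of_nonneg (le_max_right _ _)]
    exact max_le (hh_le n p) (by positivity)
  have hlim : Tendsto (fun n => ∫ p, max (h n p) 0 ∂q) atTop (𝓝 0) := by
    have := tendsto_integral_of_dominated_convergence (μ := q)
      (F := fun n p => max (h n p) 0) (f := fun _ => 0) (fun p => C * dist p.1 p.2 ^ 2)
      (fun n => ((hh_meas n).max measurable_const).aestronglyMeasurable)
      (hdist.const_mul C) (fun n => ae_of_all _ (hmax n)) (ae_of_all _ fun p => ?_)
    · simpa using this
    · rw [tendsto_order]
      refine ⟨fun a ha => Eventually.of_forall fun n => ha.trans_le (le_max_right _ _),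
        fun a ha => ?_⟩
      filter_upwards [hs.eventually (hpt' p a ha)] with n hn
      refine max_lt (lt_of_le_of_lt ?_ hn) ha
      have hs0 : 0 < s n := (hbad n).2.1
      have hfin : W2 (κ (s n) p.1) (κ (s n) p.2) ^ 2 ≠ ⊤ :=
        ne_top_of_le_ne_top (by finiteness) (hbound _ (hbad n).2 p.1 p.2)
      have := ENNReal.toReal_mono hfin (hgle n p)
      simp only [h]
      gcongr
  obtain ⟨n, hn⟩ := (hlim.eventually_lt_const hε).exists
  have hs0 : 0 < s n := (hbad n).2.1
  have := hmarkov _ (hbad n).2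
  refine (hbad n).1 (le_trans ?_ hn.le)
  have hg_int : Integrable (fun p => (g n p).toReal) q := by
    refine (hdist.const_mul (Real.exp (-K' * s n) ^ 2)).mono'
      (hgm n).ennreal_toReal.aestronglyMeasurable (ae_of_all _ fun p => ?_)
    rw [Real.norm_of_nonneg ENNReal.toReal_nonneg]
    refine ENNReal.toReal_le_of_le_ofReal (by positivity) ((hg n p).trans_eq ?_)
    rw [← mul_pow, ← ENNReal.ofReal_mul (by positivity), ENNReal.ofReal_pow (by positivity)]
  have hW : (W2 (μ.bind fun x => κ (s n) x) (ν.bind fun x => κ (s n) x)).toReal ^ 2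
      ≤ ∫ p, (g n p).toReal ∂q := by
    have hlt : ∫⁻ p, g n p ∂q ≠ ⊤ := by
      have := hg_int.2
      rw [hasFiniteIntegral_iff_ofReal (ae_of_all _ fun p => ENNReal.toReal_nonneg)] at this
      simpa only [ENNReal.ofReal_toReal (hg_top n _).ne] using this.ne
    rw [integral_toReal (hgm n).aemeasurable (ae_of_all _ (hg_top n)), ← ENNReal.toReal_pow]
    refine ENNReal.toReal_mono hlt ?_
    rw [← hgint n]
    exact W2_sq_bind_le_lintegral ENNReal.ofReal_ne_top (hcontr _ (hbad n).2) hq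
  calc (1 / s n) * (Real.exp (2 * K * s n)
        * (W2 (μ.bind fun x => κ (s n) x) (ν.bind fun x => κ (s n) x)).toReal ^ 2
          - (W2 μ ν).toReal ^ 2)
      ≤ (1 / s n) * (Real.exp (2 * K * s n) * ∫ p, (g n p).toReal ∂q
          - ∫ p, dist p.1 p.2 ^ 2 ∂q) := by rw [hdist_int]; gcongr
    _ = ∫ p, h n p ∂q := by
      simp only [h]
      rw [integral_const_mul, integral_sub (hg_int.const_mul _) hdist, integral_const_mul]
    _ ≤ ∫ p, max (h n p) 0 ∂q := by
      refine integral_mono (((hg_int.const_mul _).sub hdist).const_mul _) ?_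
        fun p => le_max_left _ _
      exact (hdist.const_mul C).mono' ((hh_meas n).max measurable_const).aestronglyMeasurable
        (ae_of_all _ (hmax n))
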